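/- Let k ≥ 1 and n ≥ k. With the same notation, det( 𝒲^∞(Z_I; Z_{σ_J}; H) )_{I,J ∈ C(n,k)} = H^{(n(n−1)/2)·binom(n−1,k−1)} · D̂(Z;H), where D̂(Z;H) = D(Z)·D(Z^{-1})·D̃(Z;H). -/

import Mathlib

noncomputable section

open MvPolynomial

/-- The rational-function field `ℂ(Z₁,…,Z_n,H)`. -/
abbrev ZF (n : ℕ) : Type := FractionRing (MvPolynomial (Fin n ⊕ Unit) ℂ)

def ZV (n : ℕ) (a : Fin n) : ZF n :=
  algebraMap (MvPolynomial (Fin n ⊕ Unit) ℂ) (ZF n) (X (Sum.inl a))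

def HV (n : ℕ) : ZF n :=
  algebraMap (MvPolynomial (Fin n ⊕ Unit) ℂ) (ZF n) (X (Sum.inr ()))

/-- The function `U(T;Z;H)` of formula (3.1). -/
def Ufun {F : Type*} [Field F] (n k : ℕ) (T : Fin k → F) (Z : Fin n → F)
    (H : F) : F :=
  ∏ i : Fin k,
    ((∏ a ∈ Finset.univ.filter (fun a : Fin n => a.1 < i.1),
        (1 - H * Z a / T i)) *
     (∏ b ∈ Finset.univ.filter (fun b : Fin n => i.1 < b.1 ∧ b.1 < k),
        (1 - Z b / T i)) *
     (∏ j ∈ Finset.univ.filter (fun j : Fin k => i < j),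
        ((1 - H * T j / T i) / (1 - T j / T i))))

/-- The reduced trigonometric weight function `𝒲(T;Z;H) = Sym_T U(T;Z;H)`. -/
def Wtrig {F : Type*} [Field F] (n k : ℕ) (T : Fin k → F) (Z : Fin n → F)
    (H : F) : F :=
  ∑ σ : Equiv.Perm (Fin k), Ufun n k (T ∘ σ) Z H

/-- The trigonometric weight function
`𝒲⁰(T;Z;H) = 𝒲(T;Z;H) ∏_{i≤k} ∏_{a>k} (1 − Z_a/T_i)`. -/
def W0 {F : Type*} [Field F] (n k : ℕ) (T : Fin k → F) (Z : Fin n → F)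
    (H : F) : F :=
  Wtrig n k T Z H *
    ∏ i : Fin k, ∏ a ∈ Finset.univ.filter (fun a : Fin n => k ≤ a.1),
      (1 - Z a / T i)

/-- `E(T;H) = ∏_i ∏_{j≠i} (1 − H·T_i/T_j)`. -/
def Efun {F : Type*} [Field F] (k : ℕ) (T : Fin k → F) (H : F) : F :=
  ∏ i : Fin k, ∏ j ∈ Finset.univ.filter (fun j : Fin k => j ≠ i),
    (1 - H * T i / T j)

/-- `R(Z) = ∏_{a≤k} ∏_{b>k} (1 − Z_b/Z_a)`. -/
def Rfun {F : Type*} [Field F] (n k : ℕ) (Z : Fin n → F) : F :=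
  ∏ a ∈ Finset.univ.filter (fun a : Fin n => a.1 < k),
    ∏ b ∈ Finset.univ.filter (fun b : Fin n => k ≤ b.1),
      (1 - Z b / Z a)

/-- The increasing enumeration of a `k`-element subset of `{1, …, n}`. -/
def enum {n k : ℕ} (I : Finset (Fin n)) (hI : I.card = k) : Fin k → Fin n :=
  fun a => (I.orderIsoOfFin hI a : Fin n)

/-- The minimal-length permutation `σ_J` with `{σ_J(1),…,σ_J(k)} = J`. -/
def permOfSubset {n k : ℕ} (hk : k ≤ n) (J : Finset (Fin n)) (hJ : J.card = k) :
    Equiv.Perm (Fin n) :=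
  (finCongr (Nat.add_sub_cancel' hk)).symm.trans <|
    finSumFinEquiv.symm.trans <|
      (Equiv.sumCongr (J.orderIsoOfFin hJ).toEquiv
          ((Jᶜ.orderIsoOfFin (by simp [Finset.card_compl, hJ])).toEquiv.trans
            (Equiv.subtypeEquivRight fun x => Finset.mem_compl))).trans
        (Equiv.sumCompl (· ∈ J))


/-- The opposite trigonometric weight function
`𝒲^∞(T;Z;H) = H^{k(k−1)/2} 𝒲(T;Z;H) ∏_{i≤k} ∏_{a>k} (1 − H·Z_a/T_i)`. -/
def Winf {F : Type*} [Field F] (n k : ℕ) (T : Fin k → F) (Z : Fin n → F)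
    (H : F) : F :=
  H ^ (k * (k - 1) / 2) * Wtrig n k T Z H *
    ∏ i : Fin k, ∏ a ∈ Finset.univ.filter (fun a : Fin n => k ≤ a.1),
      (1 - H * Z a / T i)


/-- `D(Z) = ∏_{a>b} (1 − Z_a/Z_b)^{binom(n−2,k−1)}`. -/
def Dfun {F : Type*} [Field F] (n k : ℕ) (Z : Fin n → F) : F :=
  ∏ a : Fin n, ∏ b ∈ Finset.univ.filter (fun b : Fin n => b < a),
    (1 - Z a / Z b) ^ Nat.choose (n - 2) (k - 1)

/-- `D̃(Z;H) = ∏_a ∏_{b≠a} (1 − H·Z_a/Z_b)^{binom(n−2,k−2)}`, with the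
exponent interpreted as `0` when `k = 1`. -/
def Dtil {F : Type*} [Field F] (n k : ℕ) (Z : Fin n → F) (H : F) : F :=
  ∏ a : Fin n, ∏ b ∈ Finset.univ.filter (fun b : Fin n => b ≠ a),
    (1 - H * Z a / Z b) ^ (if k = 1 then 0 else Nat.choose (n - 2) (k - 2))

/-- `D̂(Z;H) = D(Z) D(Z⁻¹) D̃(Z;H)`. -/
def Dhat {F : Type*} [Field F] (n k : ℕ) (Z : Fin n → F) (H : F) : F :=
  Dfun n k Z * Dfun n k (fun a => (Z a)⁻¹) * Dtil n k Z H

section WeightVectors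

variable {F : Type*} [Field F] {n : ℕ} (Z : Fin n → F) (H : F)

/-- The factor `(1 − H·Z_b/Z_a)/(1 − Z_b/Z_a)` of the shuffle product. -/
def shuffleFactor (a b : Fin n) : F := (1 - H * Z b / Z a) / (1 - Z b / Z a)

/-- The weight function attached to an ordered list of points, evaluated at `T = Z_I`. The points
flagged `true` are the selected ones; `C` is a factor common to all the variables `T_i`. -/
def weightVec : List (Fin n × Bool) → (Fin n → F) → Finset (Fin n) → F
  | [], _, I => if I = ∅ then 1 else 0
  | (y, true) :: l, C, I => ∑ a ∈ I, C a * (l.map fun b => 1 - Z b.1 / Z a).prod *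
      (∏ d ∈ I.erase a, shuffleFactor Z H a d) *
      weightVec l (fun t => C t * (1 - H * Z y / Z t)) (I.erase a)
  | (y, false) :: l, C, I => weightVec l (fun t => C t * (1 - H * Z y / Z t)) I

/-- Flag all the points of a list as selected. -/
def selected (l : List (Fin n)) : List (Fin n × Bool) := l.map fun a => (a, true)

/-- Flag all the points of a list as not selected. -/
def skipped (l : List (Fin n)) : List (Fin n × Bool) := l.map fun a => (a, false)

@[simp] lemma selected_nil : selected ([] : List (Fin n)) = [] := rfl

@[simp] lemma selected_cons (a : Fin n) (l : List (Fin n)) :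
    selected (a :: l) = (a, true) :: selected l := rfl

@[simp] lemma selected_append (l₁ l₂ : List (Fin n)) :
    selected (l₁ ++ l₂) = selected l₁ ++ selected l₂ := List.map_append

@[simp] lemma skipped_nil : skipped ([] : List (Fin n)) = [] := rfl

@[simp] lemma skipped_cons (a : Fin n) (l : List (Fin n)) :
    skipped (a :: l) = (a, false) :: skipped l := rfl

@[simp] lemma skipped_append (l₁ l₂ : List (Fin n)) :
    skipped (l₁ ++ l₂) = skipped l₁ ++ skipped l₂ := List.map_append

variable {Z H}

lemma prod_map_eq_of_perm_fst {l l' : List (Fin n × Bool)}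
    (h : (l.map Prod.fst).Perm (l'.map Prod.fst)) (f : Fin n → F) :
    (l.map fun b => f b.1).prod = (l'.map fun b => f b.1).prod := by
  have := (h.map f).prod_eq
  simpa [List.map_map, Function.comp_def] using this

lemma weightVec_cons_congr {l l' : List (Fin n × Bool)}
    (hp : (l.map Prod.fst).Perm (l'.map Prod.fst))
    (h : weightVec Z H l = weightVec Z H l') (x : Fin n × Bool) :
    weightVec Z H (x :: l) = weightVec Z H (x :: l') := by
  obtain ⟨y, _ | _⟩ := x
  · funext C I
    simp only [weightVec, h]
  · funext C I
    simp only [weightVec, h]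
    refine Finset.sum_congr rfl fun a _ => ?_
    rw [prod_map_eq_of_perm_fst hp fun b => 1 - Z b / Z a]

lemma weightVec_append_congr {l l' : List (Fin n × Bool)}
    (hp : (l.map Prod.fst).Perm (l'.map Prod.fst))
    (h : weightVec Z H l = weightVec Z H l') (p : List (Fin n × Bool)) :
    weightVec Z H (p ++ l) = weightVec Z H (p ++ l') := by
  induction p with
  | nil => exact h
  | cons x p ih => exact weightVec_cons_congr (by simpa using hp.append_left _) ih x

lemma weightVec_append_linear {l l₁ l₂ : List (Fin n × Bool)}
    (hp₁ : (l.map Prod.fst).Perm (l₁.map Prod.fst))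
    (hp₂ : (l.map Prod.fst).Perm (l₂.map Prod.fst)) {c₁ c₂ : F}
    (h : weightVec Z H l = c₁ • weightVec Z H l₁ + c₂ • weightVec Z H l₂)
    (p : List (Fin n × Bool)) :
    weightVec Z H (p ++ l) = c₁ • weightVec Z H (p ++ l₁) + c₂ • weightVec Z H (p ++ l₂) := by
  induction p with
  | nil => exact h
  | cons x p ih =>
    obtain ⟨y, _ | _⟩ := x
    · funext C I
      simp [weightVec, ih]
    · funext C I
      have e₁ (a : Fin n) := prod_map_eq_of_perm_fst (l := p ++ l) (l' := p ++ l₁)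
        (by simpa using hp₁.append_left _) fun b => 1 - Z b / Z a
      have e₂ (a : Fin n) := prod_map_eq_of_perm_fst (l := p ++ l) (l' := p ++ l₂)
        (by simpa using hp₂.append_left _) fun b => 1 - Z b / Z a
      simp only [List.cons_append, weightVec, ih, Pi.add_apply, Pi.smul_apply, smul_eq_mul,
        ← e₁, ← e₂, Finset.mul_sum, ← Finset.sum_add_distrib]
      exact Finset.sum_congr rfl fun a _ => by ring

lemma sum_erase_congr_of_add_swap_eq [CharZero F] (I : Finset (Fin n)) (f g : Fin n → Fin n → F)
    (h : ∀ a ∈ I, ∀ b ∈ I, a ≠ b → f a b + f b a = g a b + g b a) :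
    ∑ a ∈ I, ∑ b ∈ I.erase a, f a b = ∑ a ∈ I, ∑ b ∈ I.erase a, g a b := by
  have swap (f : Fin n → Fin n → F) :
      ∑ a ∈ I, ∑ b ∈ I.erase a, f a b = ∑ a ∈ I, ∑ b ∈ I.erase a, f b a :=
    Finset.sum_comm' fun a b => by simp only [Finset.mem_erase]; tauto
  have key : ∑ a ∈ I, ∑ b ∈ I.erase a, (f a b + f b a)
      = ∑ a ∈ I, ∑ b ∈ I.erase a, (g a b + g b a) :=
    Finset.sum_congr rfl fun a ha => Finset.sum_congr rfl fun b hb =>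
      h a ha b (Finset.mem_of_mem_erase hb) (Finset.ne_of_mem_erase hb).symm
  simp only [Finset.sum_add_distrib] at key
  rw [← swap f, ← swap g] at key
  linear_combination key / 2

lemma weightVec_swap_selected [CharZero F] (hZ : Function.Injective Z) (h0 : ∀ a, Z a ≠ 0)
    (x y : Fin n) (l : List (Fin n × Bool)) :
    weightVec Z H ((x, true) :: (y, true) :: l) = weightVec Z H ((y, true) :: (x, true) :: l) := by
  funext C I
  simp only [weightVec, Finset.mul_sum]
  refine sum_erase_congr_of_add_swap_eq I _ _ fun a ha b hb hab => ?_
  rw [← Finset.mul_prod_erase (I.erase a) _ (Finset.mem_erase.2 ⟨hab.symm, hb⟩),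
    ← Finset.mul_prod_erase (I.erase b) _ (Finset.mem_erase.2 ⟨hab, ha⟩),
    Finset.erase_right_comm (a := b) (b := a)]
  have e : (fun t => C t * (1 - H * Z y / Z t) * (1 - H * Z x / Z t))
      = fun t => C t * (1 - H * Z x / Z t) * (1 - H * Z y / Z t) := funext fun t => by ring
  simp only [List.map_cons, List.prod_cons, e]
  have key : (1 - Z y / Z a) * (1 - H * Z x / Z b) * shuffleFactor Z H a b
        + (1 - Z y / Z b) * (1 - H * Z x / Z a) * shuffleFactor Z H b a
      = (1 - Z x / Z a) * (1 - H * Z y / Z b) * shuffleFactor Z H a b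
        + (1 - Z x / Z b) * (1 - H * Z y / Z a) * shuffleFactor Z H b a := by
    have ha0 := h0 a
    have hb0 := h0 b
    have h₁ : Z a - Z b ≠ 0 := sub_ne_zero.2 (hZ.ne hab)
    have h₂ : Z b - Z a ≠ 0 := sub_ne_zero.2 (hZ.ne hab.symm)
    have e₁ : shuffleFactor Z H a b = (Z a - H * Z b) / (Z a - Z b) := by
      rw [shuffleFactor, one_sub_div ha0, one_sub_div ha0, div_div_div_cancel_right₀ ha0]
    have e₂ : shuffleFactor Z H b a = -(Z b - H * Z a) / (Z a - Z b) := by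
      rw [shuffleFactor, one_sub_div hb0, one_sub_div hb0, div_div_div_cancel_right₀ hb0,
        ← neg_sub (Z a) (Z b), div_neg, neg_div]
    rw [e₁, e₂]
    field_simp
    ring
  linear_combination C a * C b * (l.map fun b => 1 - Z b.1 / Z a).prod *
    (l.map fun c => 1 - Z c.1 / Z b).prod *
    (∏ d ∈ (I.erase a).erase b, shuffleFactor Z H a d) *
    (∏ d ∈ (I.erase a).erase b, shuffleFactor Z H b d) *
    weightVec Z H l (fun t => C t * (1 - H * Z x / Z t) * (1 - H * Z y / Z t))
      ((I.erase a).erase b) * key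

lemma weightVec_swap_of_snd_eq [CharZero F] (hZ : Function.Injective Z) (h0 : ∀ a, Z a ≠ 0)
    (x y : Fin n) (s : Bool) (l : List (Fin n × Bool)) :
    weightVec Z H ((x, s) :: (y, s) :: l) = weightVec Z H ((y, s) :: (x, s) :: l) := by
  cases s
  · funext C I
    simp only [weightVec]
    congr 1
    funext t
    ring
  · exact weightVec_swap_selected hZ h0 x y l

lemma weightVec_perm_append [CharZero F] (hZ : Function.Injective Z) (h0 : ∀ a, Z a ≠ 0)
    (s : Bool) {l l' : List (Fin n)} (h : l.Perm l') (r : List (Fin n × Bool)) :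
    weightVec Z H (l.map (fun a => (a, s)) ++ r) = weightVec Z H (l'.map (fun a => (a, s)) ++ r) := by
  induction h with
  | nil => rfl
  | cons x h ih =>
    exact weightVec_cons_congr (by simpa [Function.comp_def] using h.append_right _) ih _
  | swap x y l => exact weightVec_swap_of_snd_eq hZ h0 _ _ s _
  | trans _ _ ih₁ ih₂ => exact ih₁.trans ih₂

lemma weightVec_perm_blocks [CharZero F] (hZ : Function.Injective Z) (h0 : ∀ a, Z a ≠ 0)
    {x x' j j' y y' : List (Fin n)} (hx : x.Perm x') (hj : j.Perm j') (hy : y.Perm y') :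
    weightVec Z H (skipped x ++ (selected j ++ skipped y))
      = weightVec Z H (skipped x' ++ (selected j' ++ skipped y')) := by
  have hy' : weightVec Z H (skipped y) = weightVec Z H (skipped y') := by
    simpa [skipped] using weightVec_perm_append hZ h0 false hy []
  calc _ = weightVec Z H (skipped x' ++ (selected j ++ skipped y)) :=
        weightVec_perm_append hZ h0 false hx _
    _ = weightVec Z H (skipped x' ++ (selected j' ++ skipped y)) :=
        weightVec_append_congr (by simpa [selected, Function.comp_def] using hj.append_right _)
          (weightVec_perm_append hZ h0 true hj _) _
    _ = _ := by
        simp only [← List.append_assoc]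
        exact weightVec_append_congr (by simpa [skipped, Function.comp_def] using hy) hy' _

variable (Z H) in
/-- The four ways of selecting exactly one of two adjacent points `x`, `y` in front of the list `l`;
in each of them the selected point contributes the linear factor `1 − u/t`. -/
inductive SelectOne (x y : Fin n) (l : List (Fin n × Bool)) : F → List (Fin n × Bool) → Prop
  | fst_left : SelectOne x y l (Z y) ((x, true) :: (y, false) :: l)
  | fst_right : SelectOne x y l (H * Z y) ((y, false) :: (x, true) :: l)
  | snd_left : SelectOne x y l (Z x) ((y, true) :: (x, false) :: l)
  | snd_right : SelectOne x y l (H * Z x) ((x, false) :: (y, true) :: l)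

lemma SelectOne.perm {x y : Fin n} {l l' : List (Fin n × Bool)} {u : F}
    (h : SelectOne Z H x y l u l') : (l'.map Prod.fst).Perm (x :: y :: l.map Prod.fst) := by
  cases h
  exacts [.refl _, .swap _ _ _, .swap _ _ _, .refl _]

lemma SelectOne.weightVec_eq {x y : Fin n} {l l' : List (Fin n × Bool)} {u : F}
    (h : SelectOne Z H x y l u l') (C : Fin n → F) (I : Finset (Fin n)) :
    weightVec Z H l' C I = ∑ a ∈ I, (1 - u / Z a) * (C a * (l.map fun b => 1 - Z b.1 / Z a).prod *
      (∏ d ∈ I.erase a, shuffleFactor Z H a d) *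
      weightVec Z H l (fun t => C t * (1 - H * Z x / Z t) * (1 - H * Z y / Z t)) (I.erase a)) := by
  have e : (fun t => C t * (1 - H * Z y / Z t) * (1 - H * Z x / Z t))
      = fun t => C t * (1 - H * Z x / Z t) * (1 - H * Z y / Z t) := funext fun t => by ring
  cases h <;>
  · simp only [weightVec, List.map_cons, List.prod_cons, e]
    exact Finset.sum_congr rfl fun a _ => by ring

/-- Any three of the four ways of selecting one of two adjacent points are linearly dependent. -/
lemma weightVec_three_term {x y : Fin n} {l l₀ l₁ l₂ : List (Fin n × Bool)} {u u₁ u₂ c₁ c₂ : F}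
    (h₀ : SelectOne Z H x y l u l₀) (h₁ : SelectOne Z H x y l u₁ l₁)
    (h₂ : SelectOne Z H x y l u₂ l₂) (hc : c₁ + c₂ = 1) (hu : c₁ * u₁ + c₂ * u₂ = u)
    (p : List (Fin n × Bool)) :
    weightVec Z H (p ++ l₀) = c₁ • weightVec Z H (p ++ l₁) + c₂ • weightVec Z H (p ++ l₂) := by
  refine weightVec_append_linear (h₀.perm.trans h₁.perm.symm)
    (h₀.perm.trans h₂.perm.symm) ?_ p
  funext C I
  simp only [Pi.add_apply, Pi.smul_apply, smul_eq_mul]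
  rw [h₀.weightVec_eq, h₁.weightVec_eq, h₂.weightVec_eq, Finset.mul_sum, Finset.mul_sum,
    ← Finset.sum_add_distrib]
  refine Finset.sum_congr rfl fun a _ => ?_
  have key : 1 - u / Z a = c₁ * (1 - u₁ / Z a) + c₂ * (1 - u₂ / Z a) := by
    rw [← hu]
    linear_combination -hc
  rw [key]
  ring

lemma weightVec_skip_mem_of_front (hZ : Function.Injective Z) (hH : H ≠ 0)
    (S : Submodule F ((Fin n → F) → Finset (Fin n) → F)) (p : List (Fin n × Bool))
    (ys : List (Fin n)) : ∀ (x : Fin n) (r : List (Fin n × Bool)), (ys ++ [x]).Nodup →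
      (∀ w zs, (w :: zs).Perm (ys ++ [x]) →
        weightVec Z H (p ++ (w, false) :: (selected zs ++ r)) ∈ S) →
      weightVec Z H (p ++ (selected ys ++ (x, false) :: r)) ∈ S := by
  induction ys using List.reverseRecOn with
  | nil => exact fun x r _ h => by simpa using h x [] (.refl _)
  | append_singleton ys y ih =>
    intro x r hnd h
    have hxy : Z x - Z y ≠ 0 := sub_ne_zero.2 <| hZ.ne <| by
      rintro rfl
      simp [List.nodup_append] at hnd
    have step := weightVec_three_term (Z := Z) (H := H) (x := y) (y := x) (l := r)
      (c₁ := (Z x - H * Z y) / (H * (Z x - Z y))) (c₂ := (H * Z x - Z x) / (H * (Z x - Z y)))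
      .fst_left .fst_right .snd_right (by field_simp; ring) (by field_simp; ring)
      (p ++ selected ys)
    simp only [List.append_assoc] at step
    simp only [selected_append, selected_cons, selected_nil, List.append_assoc, List.cons_append,
      List.nil_append]
    rw [step]
    have hnd' : (ys ++ [x]).Nodup ∧ (ys ++ [y]).Nodup := by
      simp only [List.nodup_append, List.mem_append] at hnd ⊢
      simp_all
    refine S.add_mem (S.smul_mem _ (ih x _ hnd'.1 fun w zs hp => ?_))
      (S.smul_mem _ (ih y _ hnd'.2 fun w zs hp => ?_))
    · have := h w (zs ++ [y]) (by
        have := hp.append_right [y]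
        simp only [List.cons_append, List.append_assoc] at this ⊢
        exact this.trans ((List.Perm.swap _ _ _).append_left ys))
      simpa using this
    · have := h w (zs ++ [x]) (by simpa using hp.append_right [x])
      simpa using this

lemma weightVec_skip_mem_of_back (hZ : Function.Injective Z)
    (S : Submodule F ((Fin n → F) → Finset (Fin n) → F)) (r : List (Fin n × Bool))
    (ys : List (Fin n)) : ∀ (x : Fin n) (p : List (Fin n × Bool)), (x :: ys).Nodup →
      (∀ w zs, (w :: zs).Perm (x :: ys) →
        weightVec Z H (p ++ (selected zs ++ (w, false) :: r)) ∈ S) →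
      weightVec Z H (p ++ (x, false) :: (selected ys ++ r)) ∈ S := by
  induction ys with
  | nil => exact fun x p _ h => by simpa using h x [] (.refl _)
  | cons y ys ih =>
    intro x p hnd h
    have hxy : Z x - Z y ≠ 0 := sub_ne_zero.2 <| hZ.ne <| by
      rintro rfl
      simp at hnd
    have step := weightVec_three_term (Z := Z) (H := H) (x := y) (y := x) (l := selected ys ++ r)
      (c₁ := (H * Z x - Z y) / (Z x - Z y)) (c₂ := (Z x - H * Z x) / (Z x - Z y))
      .fst_right .fst_left .snd_left (by field_simp; ring) (by field_simp; ring) p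
    simp only [selected_cons, List.cons_append]
    rw [step]
    have hnd' : (x :: ys).Nodup ∧ (y :: ys).Nodup := by simp_all
    refine S.add_mem (S.smul_mem _ ?_) (S.smul_mem _ ?_)
    · have := ih x (p ++ [(y, true)]) hnd'.1 fun w zs hp => by
        simpa using h w (y :: zs)
          ((List.Perm.swap _ _ _).trans ((hp.cons y).trans (List.Perm.swap _ _ _)))
      simpa using this
    · have := ih y (p ++ [(x, true)]) hnd'.2 fun w zs hp => by
        simpa using h w (x :: zs) ((List.Perm.swap _ _ _).trans (hp.cons x))
      simpa using this

/-- Moving a skipped point `z` to the right through selected points, modulo vectors in which some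
other point is skipped in front. -/
lemma weightVec_move_right_front (hZ : Function.Injective Z) (hH : H ≠ 0)
    (hHZ : ∀ a b, a ≠ b → H * Z a ≠ Z b)
    (S : Submodule F ((Fin n → F) → Finset (Fin n) → F)) (p r : List (Fin n × Bool)) (z : Fin n)
    (j : List (Fin n)) : ∀ d : List (Fin n), (z :: (d ++ j)).Nodup →
      (∀ w zs, w ∈ d ++ j → (w :: zs).Perm (z :: (d ++ j)) →
        weightVec Z H (p ++ (w, false) :: (selected zs ++ r)) ∈ S) →
      weightVec Z H (p ++ (selected d ++ (z, false) :: (selected j ++ r)))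
        - (j.map fun x => H * (Z x - Z z) / (H * Z x - Z z)).prod •
          weightVec Z H (p ++ (selected (d ++ j) ++ (z, false) :: r)) ∈ S := by
  induction j with
  | nil => intro d _ _; simp
  | cons x j ih =>
    intro d hnd h
    have hxz : x ≠ z := by
      rintro rfl
      simp at hnd
    have hxz' : H * Z x - Z z ≠ 0 := sub_ne_zero.2 (hHZ x z hxz)
    have step := weightVec_three_term (Z := Z) (H := H) (x := x) (y := z) (l := selected j ++ r)
      (c₁ := H * (Z x - Z z) / (H * Z x - Z z)) (c₂ := (H * Z z - Z z) / (H * Z x - Z z))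
      .fst_right .fst_left .snd_right (by field_simp; ring) (by field_simp; ring)
      (p ++ selected d)
    simp only [List.append_assoc] at step
    simp only [selected_cons, List.cons_append, List.map_cons, List.prod_cons]
    rw [step]
    have main := ih (d ++ [x]) (by simpa using hnd) (by simpa using h)
    have hmem := weightVec_skip_mem_of_front (Z := Z) (H := H) hZ hH S p d x
      ((z, true) :: (selected j ++ r)) (by
        have : (d ++ x :: j).Nodup := (List.nodup_cons.1 hnd).2
        exact this.sublist (List.Sublist.append_left (by simp) d)) fun w zs hp => by
        have := h w (zs ++ z :: j) (by
            have : w ∈ d ++ [x] := hp.subset (by simp)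
            simp at this ⊢
            tauto) (by
            have := hp.append_right (z :: j)
            refine this.trans ?_
            simpa using List.perm_middle (a := z) (l₁ := d ++ [x]) (l₂ := j))
        simpa using this
    have : ∀ (c α e : F) (A B D : (Fin n → F) → Finset (Fin n) → F),
        c • A + e • D - (c * α) • B = c • (A - α • B) + e • D := by
      intros; module
    simp only [selected_append, selected_cons, selected_nil, List.append_assoc, List.cons_append,
      List.nil_append] at main ⊢
    rw [this]
    exact S.add_mem (S.smul_mem _ main) (S.smul_mem _ hmem)

/-- Moving a skipped point `z` to the right through selected points, modulo vectors in which some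
other point is skipped at the back. -/
lemma weightVec_move_right_back (hZ : Function.Injective Z)
    (S : Submodule F ((Fin n → F) → Finset (Fin n) → F)) (r : List (Fin n × Bool)) (z : Fin n)
    (j : List (Fin n)) : ∀ p : List (Fin n × Bool), (z :: j).Nodup →
      (∀ w zs, w ∈ j → (w :: zs).Perm (z :: j) →
        weightVec Z H (p ++ (selected zs ++ (w, false) :: r)) ∈ S) →
      weightVec Z H (p ++ (z, false) :: (selected j ++ r))
        - (j.map fun x => (Z x - H * Z z) / (Z x - Z z)).prod •
          weightVec Z H (p ++ (selected j ++ (z, false) :: r)) ∈ S := by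
  induction j with
  | nil => intro p _ _; simp
  | cons x j ih =>
    intro p hnd h
    have hxz : x ≠ z := by
      rintro rfl
      simp at hnd
    have hxz' : Z x - Z z ≠ 0 := sub_ne_zero.2 (hZ.ne hxz)
    have step := weightVec_three_term (Z := Z) (H := H) (x := x) (y := z) (l := selected j ++ r)
      (c₁ := (Z x - H * Z z) / (Z x - Z z)) (c₂ := (H * Z z - Z z) / (Z x - Z z))
      .fst_right .fst_left .snd_left (by field_simp; ring) (by field_simp; ring) p
    simp only [selected_cons, List.cons_append, List.map_cons, List.prod_cons]
    rw [step]
    have hnd' : (z :: j).Nodup ∧ (x :: j).Nodup := by simp_all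
    have main := ih (p ++ [(x, true)]) hnd'.1 fun w zs hw hp => by
      simpa using h w (x :: zs) (by simp [hw])
        ((List.Perm.swap _ _ _).trans ((hp.cons x).trans (List.Perm.swap _ _ _)))
    have hmem := weightVec_skip_mem_of_back (Z := Z) (H := H) hZ S r j x
      (p ++ [(z, true)]) hnd'.2 fun w zs hp => by
        simpa using h w (z :: zs) (hp.subset (by simp))
          ((List.Perm.swap _ _ _).trans (hp.cons z))
    have : ∀ (c α e : F) (A B D : (Fin n → F) → Finset (Fin n) → F),
        c • A + e • D - (c * α) • B = c • (A - α • B) + e • D := by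
      intros; module
    simp only [List.append_assoc, List.cons_append, List.nil_append] at main hmem ⊢
    rw [this]
    exact S.add_mem (S.smul_mem _ main) (S.smul_mem _ hmem)

/-- The points of the `m`-th chamber of `J`: first the points outside `J` of index below `m`,
then the selected points of `J`, then the remaining points. -/
def chamber (m : ℕ) (J : Finset (Fin n)) : List (Fin n × Bool) :=
  skipped (Finset.univ.filter fun a : Fin n => a.1 < m ∧ a ∉ J).toList ++
    (selected J.toList ++ skipped (Finset.univ.filter fun a : Fin n => m ≤ a.1 ∧ a ∉ J).toList)

lemma List.Nodup.perm_toList {α : Type*} {l : List α} (hl : l.Nodup) {s : Finset α}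
    (h : ∀ a, a ∈ l ↔ a ∈ s) : l.Perm s.toList :=
  (List.perm_ext_iff_of_nodup hl s.nodup_toList).2 fun a => by rw [h, Finset.mem_toList]

lemma weightVec_eq_chamber [CharZero F] (hZ : Function.Injective Z) (h0 : ∀ a, Z a ≠ 0)
    {m : ℕ} {J : Finset (Fin n)} {x j y : List (Fin n)} (hnd : (x ++ (j ++ y)).Nodup)
    (hx : ∀ a, a ∈ x ↔ a.1 < m ∧ a ∉ J) (hj : ∀ a, a ∈ j ↔ a ∈ J)
    (hy : ∀ a, a ∈ y ↔ m ≤ a.1 ∧ a ∉ J) :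
    weightVec Z H (skipped x ++ (selected j ++ skipped y)) = weightVec Z H (chamber m J) := by
  rw [List.nodup_append, List.nodup_append] at hnd
  exact weightVec_perm_blocks hZ h0 (hnd.1.perm_toList fun a => by simp [hx])
    (hnd.2.1.1.perm_toList hj) (hnd.2.1.2.1.perm_toList fun a => by simp [hy])

variable (Z H) in
/-- The coefficient acquired when the skipped point `z` is moved across the selected point `x`. -/
def crossingFactor (x z : Fin n) : F :=
  if x < z then H * (Z x - Z z) / (H * Z x - Z z) else (Z x - H * Z z) / (Z x - Z z)

lemma chamber_succ_of_mem {m : ℕ} (hm : m < n) {J : Finset (Fin n)} (hJ : (⟨m, hm⟩ : Fin n) ∈ J) :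
    chamber (m + 1) J = chamber m J := by
  have key (a : Fin n) (ha : a ∉ J) : a.1 ≠ m := by
    rintro rfl
    exact ha hJ
  unfold chamber
  congr 3
  · ext a
    simp only [Finset.mem_filter, Finset.mem_univ, true_and]
    constructor <;> rintro ⟨h₁, h₂⟩ <;> refine ⟨?_, h₂⟩ <;> have := key a h₂ <;> omega
  · congr 2
    ext a
    constructor <;> rintro ⟨h₁, h₂⟩ <;> refine ⟨?_, h₂⟩ <;> have := key a h₂ <;> omega

lemma weightVec_chamber_succ [CharZero F] (hZ : Function.Injective Z) (h0 : ∀ a, Z a ≠ 0)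
    (hH : H ≠ 0) (hHZ : ∀ a b, a ≠ b → H * Z a ≠ Z b) {k m : ℕ} (hm : m < n)
    {J : Finset (Fin n)} (hJ : (⟨m, hm⟩ : Fin n) ∉ J) (hk : J.card = k)
    (S : Submodule F ((Fin n → F) → Finset (Fin n) → F))
    (hS : ∀ K : Finset (Fin n), K.card = k → ⟨m, hm⟩ ∈ K → weightVec Z H (chamber m K) ∈ S) :
    weightVec Z H (chamber (m + 1) J)
      - (∏ x ∈ J, crossingFactor Z H x ⟨m, hm⟩) • weightVec Z H (chamber m J) ∈ S := by
  set z : Fin n := ⟨m, hm⟩ with hz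
  set X := (Finset.univ.filter fun a : Fin n => a.1 < m ∧ a ∉ J).toList with hX
  set Y := (Finset.univ.filter fun a : Fin n => m < a.1 ∧ a ∉ J).toList with hY
  set j₁ := (J.filter fun a => a < z).toList with hj₁
  set j₂ := (J.filter fun a => ¬ a < z).toList with hj₂
  have mX (a) : a ∈ X ↔ a.1 < m ∧ a ∉ J := by simp [hX]
  have mY (a) : a ∈ Y ↔ m < a.1 ∧ a ∉ J := by simp [hY]
  have mj₁ (a) : a ∈ j₁ ↔ a ∈ J ∧ a.1 < m := by simp [hj₁, hz, Fin.lt_def]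
  have mj₂ (a) : a ∈ j₂ ↔ a ∈ J ∧ m < a.1 := by
    simp only [hj₂, hz, Fin.lt_def, Finset.mem_toList, Finset.mem_filter, not_lt]
    refine and_congr_right fun ha => ⟨fun h => lt_of_le_of_ne h ?_, le_of_lt⟩
    rintro rfl
    exact hJ ha
  have nd : (X ++ z :: (j₁ ++ (j₂ ++ Y))).Nodup := by
    have ndX : X.Nodup := Finset.nodup_toList _
    have ndY : Y.Nodup := Finset.nodup_toList _
    have nd₁ : j₁.Nodup := Finset.nodup_toList _
    have nd₂ : j₂.Nodup := Finset.nodup_toList _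
    simp only [List.nodup_append, List.nodup_cons, List.mem_append, List.mem_cons, ndX, ndY, nd₁,
      nd₂, mX, mY, mj₁, mj₂]
    refine ⟨trivial, ⟨?_, trivial, ⟨trivial, trivial, ?_⟩, ?_⟩, ?_⟩
    · simp [hz]
    · rintro a ha b hb rfl
      exact hb.2 ha.1
    · rintro a ha b (hb | hb) rfl
      · omega
      · exact hb.2 ha.1
    · rintro a ha b (hb | hb | hb | hb) rfl
      · simp [hb, hz] at ha
      · exact ha.2 hb.1
      · exact ha.2 hb.1
      · omega
  have coeff : ∏ x ∈ J, crossingFactor Z H x z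
      = (j₁.map fun x => H * (Z x - Z z) / (H * Z x - Z z)).prod *
        (j₂.map fun x => (Z x - H * Z z) / (Z x - Z z)).prod := by
    rw [hj₁, hj₂, Finset.prod_map_toList, Finset.prod_map_toList,
      ← Finset.prod_filter_mul_prod_filter_not J fun a => a < z]
    congr 1 <;> refine Finset.prod_congr rfl fun x hx => ?_ <;>
      simp [crossingFactor, (Finset.mem_filter.1 hx).2]
  have mem_of (w : Fin n) (l : List (Fin n × Bool)) (x j y : List (Fin n)) (hw : w ∈ J)
      (hl : l = skipped x ++ (selected j ++ skipped y))
      (hp : (x ++ (j ++ y)).Perm (X ++ z :: (j₁ ++ (j₂ ++ Y))))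
      (hx : ∀ a, a ∈ x ↔ a ∈ X ∨ a = w ∧ a.1 < m) (hy : ∀ a, a ∈ y ↔ a ∈ Y ∨ a = w ∧ m < a.1) :
      weightVec Z H l ∈ S := by
    have hwz : z ≠ w := fun h => hJ (h ▸ hw)
    have nd' := hp.nodup_iff.2 nd
    have hwm : w.1 ≠ m := fun h => hwz (Fin.ext h.symm)
    have hcard : (insert z (J.erase w)).card = k := by
      rw [Finset.card_insert_of_notMem (by simp [hJ]), Finset.card_erase_of_mem hw, hk]
      have := Finset.card_pos.2 ⟨w, hw⟩
      omega
    have mz (a : Fin n) : a = z ↔ a.1 = m := by simp [hz, Fin.ext_iff]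
    have hx' (a : Fin n) : a ∈ x ↔ a.1 < m ∧ a ∉ insert z (J.erase w) := by
      rw [hx, mX, Finset.mem_insert, Finset.mem_erase, mz]
      by_cases haw : a = w
      · subst haw
        simp [hw, hwm]
      · simp only [haw, false_and, or_false, ne_eq, not_false_eq_true, true_and]
        constructor <;> rintro ⟨h₁, h₂⟩ <;> refine ⟨h₁, ?_⟩
        · rintro (h | h)
          · omega
          · exact h₂ h
        · exact fun h => h₂ (Or.inr h)
    have hy' (a : Fin n) : a ∈ y ↔ m ≤ a.1 ∧ a ∉ insert z (J.erase w) := by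
      rw [hy, mY, Finset.mem_insert, Finset.mem_erase, mz]
      by_cases haw : a = w
      · subst haw
        simp [hw, hwm]
        omega
      · simp only [haw, false_and, or_false, ne_eq, not_false_eq_true, true_and]
        constructor
        · rintro ⟨h₁, h₂⟩
          refine ⟨h₁.le, ?_⟩
          rintro (h | h)
          · omega
          · exact h₂ h
        · rintro ⟨h₁, h₂⟩
          exact ⟨lt_of_le_of_ne h₁ fun h => h₂ (Or.inl h.symm), fun h => h₂ (Or.inr h)⟩
    have hj' (a : Fin n) : a ∈ j ↔ a ∈ insert z (J.erase w) := by
      have hall : a ∈ x ++ (j ++ y) := by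
        refine hp.symm.subset ?_
        simp only [List.mem_append, List.mem_cons, mX, mY, mj₁, mj₂, mz]
        by_cases haJ : a ∈ J <;> simp [haJ] <;> omega
      rw [List.nodup_append, List.nodup_append] at nd'
      rw [List.mem_append, List.mem_append] at hall
      constructor
      · intro ha
        by_contra hc
        rcases lt_or_ge a.1 m with h | h
        · exact nd'.2.2 a ((hx' a).2 ⟨h, hc⟩) a (by simp [ha]) rfl
        · exact nd'.2.1.2.2 a ha a ((hy' a).2 ⟨h, hc⟩) rfl
      · intro ha
        rcases hall with h | h | h
        · exact absurd ha ((hx' a).1 h).2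
        · exact h
        · exact absurd ha ((hy' a).1 h).2
    rw [hl, weightVec_eq_chamber hZ h0 nd' hx' hj' hy']
    exact hS _ hcard (Finset.mem_insert_self _ _)
  have e₁ : weightVec Z H (chamber (m + 1) J)
      = weightVec Z H (skipped X ++ (z, false) :: (selected j₁ ++ (selected j₂ ++ skipped Y))) := by
    rw [← weightVec_eq_chamber (m := m + 1) (J := J) (x := X ++ [z]) (j := j₁ ++ j₂) (y := Y) hZ h0
      (by simpa using nd)]
    · simp
    · intro a
      simp only [List.mem_append, mX, List.mem_singleton, hz, Fin.ext_iff]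
      constructor
      · rintro (h | h)
        · exact ⟨by omega, h.2⟩
        · exact ⟨by omega, by rwa [show a = z from Fin.ext h]⟩
      · rintro ⟨h₁, h₂⟩
        rcases Nat.lt_succ_iff_lt_or_eq.1 h₁ with h | h
        · exact Or.inl ⟨h, h₂⟩
        · exact Or.inr h
    · intro a
      simp only [List.mem_append, mj₁, mj₂]
      refine ⟨fun h => by tauto, fun ha => ?_⟩
      have : a.1 ≠ m := fun h => hJ (by rwa [show z = a from Fin.ext h.symm])
      rcases lt_or_gt_of_ne this with h | h
      · exact Or.inl ⟨ha, h⟩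
      · exact Or.inr ⟨ha, h⟩
    · intro a
      rw [mY]
      rfl
  have e₂ : weightVec Z H (chamber m J)
      = weightVec Z H (skipped X ++ (selected j₁ ++ (selected j₂ ++ (z, false) :: skipped Y))) := by
    rw [← weightVec_eq_chamber (m := m) (J := J) (x := X) (j := j₁ ++ j₂) (y := z :: Y) hZ h0]
    · simp
    · refine List.Perm.nodup_iff (List.Perm.append_left X ?_) |>.2 nd
      simpa using List.perm_middle (a := z) (l₁ := j₁ ++ j₂) (l₂ := Y)
    · exact mX
    · intro a
      simp only [List.mem_append, mj₁, mj₂]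
      refine ⟨fun h => by tauto, fun ha => ?_⟩
      have : a.1 ≠ m := fun h => hJ (by rwa [show z = a from Fin.ext h.symm])
      rcases lt_or_gt_of_ne this with h | h
      · exact Or.inl ⟨ha, h⟩
      · exact Or.inr ⟨ha, h⟩
    · intro a
      simp only [List.mem_cons, mY, hz, Fin.ext_iff]
      constructor
      · rintro (h | h)
        · exact ⟨by omega, by rwa [show a = z from Fin.ext h]⟩
        · exact ⟨h.1.le, h.2⟩
      · rintro ⟨h₁, h₂⟩
        rcases Nat.lt_or_eq_of_le h₁ with h | h
        · exact Or.inr ⟨h, h₂⟩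
        · exact Or.inl h.symm
  have nd₁ : (z :: ([] ++ j₁)).Nodup :=
    nd.sublist (((List.sublist_append_left _ _).cons_cons z).trans (List.sublist_append_right _ _))
  have nd₂ : (z :: j₂).Nodup := nd.sublist <|
    (((List.sublist_append_left _ _).trans (List.sublist_append_right _ _)).cons_cons z).trans
      (List.sublist_append_right _ _)
  have front := weightVec_move_right_front (Z := Z) (H := H) hZ hH hHZ S (skipped X)
    (selected j₂ ++ skipped Y) z j₁ [] nd₁ fun w zs hw hp => by
      have hw' := (mj₁ w).1 (by simpa using hw)
      refine mem_of w _ (X ++ [w]) (zs ++ j₂) Y hw'.1 (by simp) ?_ (fun a => ?_) (fun a => ?_)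
      · have := (hp.append_right (j₂ ++ Y)).append_left X
        simpa using this
      · rw [List.mem_append, List.mem_singleton]
        refine or_congr Iff.rfl ⟨?_, And.left⟩
        rintro rfl
        exact ⟨rfl, hw'.2⟩
      · refine ⟨Or.inl, ?_⟩
        rintro (h | ⟨rfl, h⟩)
        · exact h
        · omega
  have back := weightVec_move_right_back (Z := Z) (H := H) hZ S (skipped Y) z j₂
    (skipped X ++ selected j₁) nd₂ fun w zs hw hp => by
      have hw' := (mj₂ w).1 hw
      refine mem_of w _ X (j₁ ++ zs) (w :: Y) hw'.1 (by simp) ?_ (fun a => ?_) (fun a => ?_)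
      · refine List.Perm.append_left X ?_
        have h₁ : (zs ++ w :: Y).Perm (z :: (j₂ ++ Y)) :=
          List.perm_middle.trans (hp.append_right Y)
        have h₂ := h₁.append_left j₁
        rw [List.append_assoc]
        exact h₂.trans List.perm_middle
      · refine ⟨Or.inl, ?_⟩
        rintro (h | ⟨rfl, h⟩)
        · exact h
        · omega
      · rw [List.mem_cons, or_comm]
        refine or_congr Iff.rfl ⟨?_, And.left⟩
        rintro rfl
        exact ⟨rfl, hw'.2⟩
  simp only [List.nil_append, selected_nil, List.append_assoc] at front back
  rw [e₁, e₂, coeff]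
  have split : ∀ (c d : F) (A B D : (Fin n → F) → Finset (Fin n) → F),
      A - (c * d) • D = (A - c • B) + c • (B - d • D) := by
    intros; module
  rw [split _ _ _ (weightVec Z H
    (skipped X ++ (selected j₁ ++ (z, false) :: (selected j₂ ++ skipped Y))))]
  exact S.add_mem front (S.smul_mem _ back)

lemma det_eq_prod_mul_det_of_column_operations {ι : Type*} [Fintype ι] [DecidableEq ι]
    (M N : Matrix ι ι F) (p : ι → Prop) [DecidablePred p] (α : ι → F)
    (hp : ∀ J, p J → ∀ I, N I J = M I J)
    (hn : ∀ J, ¬ p J → ∃ β : ι → F, (∀ K, ¬ p K → β K = 0) ∧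
      ∀ I, N I J = α J * M I J + ∑ K, β K * M I K) :
    N.det = (∏ J with ¬ p J, α J) * M.det := by
  choose! β hβ hN using hn
  let B : Matrix ι ι F := Matrix.of fun K J =>
    if p J then (if K = J then 1 else 0) else (if K = J then α J else 0) + β J K
  have hB : N = M * B := by
    ext I J
    by_cases hJ : p J
    · simp [Matrix.mul_apply, B, hJ, hp J hJ I]
    · simp [Matrix.mul_apply, B, hJ, hN J hJ I, mul_add, Finset.sum_add_distrib, mul_comm]
  have h₁ : B.toSquareBlockProp p = 1 := by
    ext K J
    simp [Matrix.toSquareBlockProp_def, B, J.2, Matrix.one_apply, Subtype.ext_iff]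
  have h₂ : B.toSquareBlockProp (fun J => ¬ p J) = Matrix.diagonal fun J => α J.1 := by
    ext K J
    simp [Matrix.toSquareBlockProp_def, B, J.2, Matrix.diagonal_apply, Subtype.ext_iff,
      hβ J.1 J.2 K.1 K.2]
    split_ifs with h
    · rw [h]
    · rfl
  have hdet : B.det = ∏ J with ¬ p J, α J := by
    rw [B.twoBlockTriangular_det p, h₁, h₂, Matrix.det_one, one_mul, Matrix.det_diagonal]
    · exact (Finset.prod_subtype _ (by simp) α).symm
    · intro K hK J hJ
      have : K ≠ J := fun h => hK (h ▸ hJ)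
      simp [B, hJ, this]
  rw [hB, Matrix.det_mul, hdet, mul_comm]

variable (Z H) in
/-- The matrix of values at `T = Z_I` of the weight functions of the `m`-th chambers. -/
def chamberMatrix (k m : ℕ) :
    Matrix {s : Finset (Fin n) // s.card = k} {s : Finset (Fin n) // s.card = k} F :=
  Matrix.of fun I J => weightVec Z H (chamber m J.1) (fun _ => 1) I.1

lemma det_chamberMatrix_succ [CharZero F] (hZ : Function.Injective Z) (h0 : ∀ a, Z a ≠ 0)
    (hH : H ≠ 0) (hHZ : ∀ a b, a ≠ b → H * Z a ≠ Z b) (k : ℕ) {m : ℕ} (hm : m < n) :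
    (chamberMatrix Z H k (m + 1)).det =
      (∏ J : {s : Finset (Fin n) // s.card = k} with ¬ (⟨m, hm⟩ : Fin n) ∈ J.1,
        ∏ x ∈ J.1, crossingFactor Z H x ⟨m, hm⟩) * (chamberMatrix Z H k m).det := by
  refine det_eq_prod_mul_det_of_column_operations _ _
    (fun J : {s : Finset (Fin n) // s.card = k} => (⟨m, hm⟩ : Fin n) ∈ J.1)
    (fun J => ∏ x ∈ J.1, crossingFactor Z H x ⟨m, hm⟩) (fun J hJ I => ?_) fun J hJ => ?_
  · simp [chamberMatrix, chamber_succ_of_mem hm hJ]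
  · have h := weightVec_chamber_succ hZ h0 hH hHZ hm hJ J.2
      (Submodule.span F (Set.range fun K : {s : Finset (Fin n) // s.card = k} =>
        if (⟨m, hm⟩ : Fin n) ∈ K.1 then weightVec Z H (chamber m K.1) else 0)) fun K hK hmK =>
        Submodule.subset_span ⟨⟨K, hK⟩, by simp [hmK]⟩
    obtain ⟨c, hc⟩ := (Submodule.mem_span_range_iff_exists_fun F).1 h
    refine ⟨fun K => if (⟨m, hm⟩ : Fin n) ∈ K.1 then c K else 0, fun K hK => by simp [hK],
      fun I => ?_⟩
    have := congrFun (congrFun hc fun _ => 1) I.1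
    simp only [Finset.sum_apply, Pi.smul_apply, Pi.sub_apply, smul_eq_mul] at this
    simp only [chamberMatrix, Matrix.of_apply]
    rw [← sub_eq_iff_eq_add', ← this]
    refine Finset.sum_congr rfl fun K _ => ?_
    split_ifs <;> simp

lemma det_chamberMatrix [CharZero F] (hZ : Function.Injective Z) (h0 : ∀ a, Z a ≠ 0)
    (hH : H ≠ 0) (hHZ : ∀ a b, a ≠ b → H * Z a ≠ Z b) (k : ℕ) {m : ℕ} (hm : m ≤ n) :
    (chamberMatrix Z H k m).det =
      (∏ z : Fin n with z.1 < m, ∏ J : {s : Finset (Fin n) // s.card = k} with z ∉ J.1,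
        ∏ x ∈ J.1, crossingFactor Z H x z) * (chamberMatrix Z H k 0).det := by
  induction m with
  | zero => simp
  | succ m ih =>
    have hins : (Finset.univ.filter fun z : Fin n => z.1 < m + 1)
        = insert ⟨m, hm⟩ (Finset.univ.filter fun z : Fin n => z.1 < m) := by
      ext z
      simp [Fin.ext_iff]
      omega
    rw [det_chamberMatrix_succ hZ h0 hH hHZ k hm, ih (Nat.le_of_succ_le hm), hins,
      Finset.prod_insert (by simp), mul_assoc]

lemma weightVec_selected_skipped_eq_zero (h0 : ∀ a, Z a ≠ 0) (r : List (Fin n)) {a : Fin n}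
    (har : a ∈ r) (l : List (Fin n)) : ∀ (C : Fin n → F) (I : Finset (Fin n)), a ∈ I →
      weightVec Z H (selected l ++ skipped r) C I = 0 := by
  have hnil : ∀ (r : List (Fin n)) (C : Fin n → F) (I : Finset (Fin n)), a ∈ I →
      weightVec Z H (skipped r) C I = 0 := by
    intro r
    induction r with
    | nil => exact fun C I hI => by simp [weightVec, Finset.ne_empty_of_mem hI]
    | cons y r ih => exact fun C I hI => by simpa [weightVec] using ih _ I hI
  induction l with
  | nil => exact fun C I hI => by simpa using hnil r C I hI
  | cons y l ih =>
    intro C I hI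
    simp only [selected_cons, List.cons_append, weightVec]
    refine Finset.sum_eq_zero fun b _ => ?_
    by_cases hb : b = a
    · have : ((selected l ++ skipped r).map fun c => 1 - Z c.1 / Z b).prod = 0 := by
        refine List.prod_eq_zero (List.mem_map.2 ⟨(a, false), ?_, ?_⟩)
        · simp [skipped, har]
        · simp [hb, h0]
      rw [this]
      ring
    · rw [ih _ _ (Finset.mem_erase.2 ⟨Ne.symm hb, hI⟩), mul_zero]

lemma prod_insert_prod_erase {s : Finset (Fin n)} {y : Fin n} (hy : y ∉ s)
    (g : Fin n → Fin n → F) :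
    ∏ a ∈ insert y s, ∏ b ∈ (insert y s).erase a, g a b
      = (∏ b ∈ s, g y b) * (∏ a ∈ s, g a y) * ∏ a ∈ s, ∏ b ∈ s.erase a, g a b := by
  rw [Finset.prod_insert hy, Finset.erase_insert hy, mul_assoc]
  congr 1
  rw [← Finset.prod_mul_distrib]
  refine Finset.prod_congr rfl fun a ha => ?_
  have hya : y ≠ a := fun h => hy (h ▸ ha)
  rw [Finset.erase_insert_of_ne hya, Finset.prod_insert (by simp [hy])]

lemma weightVec_selected_skipped_self (hZ : Function.Injective Z) (h0 : ∀ a, Z a ≠ 0)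
    (r : List (Fin n)) (l : List (Fin n)) : ∀ C : Fin n → F, l.Nodup →
      weightVec Z H (selected l ++ skipped r) C l.toFinset =
        (∏ a ∈ l.toFinset, C a) *
        (∏ a ∈ l.toFinset, ∏ b ∈ l.toFinset.erase a, (1 - H * Z a / Z b)) *
        ∏ a ∈ l.toFinset, (r.map fun b => 1 - Z b / Z a).prod := by
  have hnil : ∀ (r : List (Fin n)) (C : Fin n → F), weightVec Z H (skipped r) C ∅ = 1 := by
    intro r
    induction r with
    | nil => exact fun C => by simp [weightVec]
    | cons y r ih => exact fun C => by simpa [weightVec] using ih _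
  induction l with
  | nil => exact fun C _ => by simpa using hnil r C
  | cons y l ih =>
    intro C hnd
    obtain ⟨hy, hl⟩ := List.nodup_cons.1 hnd
    have hy' : y ∉ l.toFinset := by simpa using hy
    simp only [selected_cons, List.cons_append, weightVec, List.toFinset_cons]
    rw [Finset.sum_eq_single_of_mem y (Finset.mem_insert_self _ _), Finset.erase_insert hy',
      ih _ hl, prod_insert_prod_erase hy', Finset.prod_insert hy', Finset.prod_insert hy',
      Finset.prod_mul_distrib]
    · have key : (l.map fun b => 1 - Z b / Z y).prod * ∏ d ∈ l.toFinset, shuffleFactor Z H y d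
          = ∏ a ∈ l.toFinset, (1 - H * Z a / Z y) := by
        rw [← List.prod_toFinset _ hl, ← Finset.prod_mul_distrib]
        refine Finset.prod_congr rfl fun b hb => ?_
        have hne : Z y - Z b ≠ 0 := sub_ne_zero.2 <| hZ.ne fun h => hy' (h ▸ hb)
        rw [shuffleFactor, mul_div_cancel₀]
        rw [one_sub_div (h0 y)]
        exact div_ne_zero hne (h0 y)
      have hsplit : ((selected l ++ skipped r).map fun b => 1 - Z b.1 / Z y).prod
          = (l.map fun b => 1 - Z b / Z y).prod * (r.map fun b => 1 - Z b / Z y).prod := by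
        simp [selected, skipped, Function.comp_def]
      rw [hsplit, ← key]
      ring
    · intro b hb hby
      have hbl : b ∈ l := by simpa [hby] using hb
      have : ((selected l ++ skipped r).map fun c => 1 - Z c.1 / Z b).prod = 0 := by
        refine List.prod_eq_zero (List.mem_map.2 ⟨(b, true), ?_, ?_⟩)
        · simp [selected, hbl]
        · simp [h0]
      rw [this]
      ring

lemma det_chamberMatrix_zero (hZ : Function.Injective Z) (h0 : ∀ a, Z a ≠ 0) (k : ℕ) :
    (chamberMatrix Z H k 0).det = ∏ J : {s : Finset (Fin n) // s.card = k},
      ((∏ a ∈ J.1, ∏ b ∈ J.1.erase a, (1 - H * Z a / Z b)) *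
        ∏ a ∈ J.1, ∏ b ∈ J.1ᶜ, (1 - Z b / Z a)) := by
  have hch (J : Finset (Fin n)) : chamber 0 J = selected J.toList ++ skipped Jᶜ.toList := by
    have : (Finset.univ.filter fun a => a ∉ J) = Jᶜ := by ext; simp
    simp [chamber, this]
  rw [← Matrix.det_diagonal]
  congr 1
  ext I J
  rw [Matrix.diagonal_apply]
  simp only [chamberMatrix, Matrix.of_apply, hch]
  split_ifs with hIJ
  · subst hIJ
    have := weightVec_selected_skipped_self (H := H) hZ h0 I.1ᶜ.toList I.1.toList (fun _ => 1)
      I.1.nodup_toList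
    simpa using this
  · obtain ⟨a, haI, haJ⟩ : ∃ a ∈ I.1, a ∉ J.1 := by
      by_contra! h
      exact hIJ (Subtype.ext (Finset.eq_of_subset_of_card_le h (by rw [I.2, J.2])))
    exact weightVec_selected_skipped_eq_zero h0 _ (by simpa using haJ) _ _ _ haI

lemma weightVec_selected_ofFn {k : ℕ} : ∀ (y e : Fin k → Fin n) (C : Fin n → F),
    Function.Injective e →
    weightVec Z H (selected (List.ofFn y)) C (Finset.univ.image e) =
      ∑ σ : Equiv.Perm (Fin k), ∏ i, (C (e (σ i)) *
        (∏ a with a < i, (1 - H * Z (y a) / Z (e (σ i)))) *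
        (∏ b with i < b, (1 - Z (y b) / Z (e (σ i)))) *
        ∏ j with i < j, shuffleFactor Z H (e (σ i)) (e (σ j))) := by
  induction k with
  | zero => intro y e C _; simp [weightVec]
  | succ k ih =>
    intro y e C he
    rw [List.ofFn_succ, selected_cons, weightVec, Finset.sum_image he.injOn,
      ← Equiv.Perm.decomposeFin.symm.sum_comp, Fintype.sum_prod_type]
    refine Finset.sum_congr rfl fun p _ => ?_
    have he' : Function.Injective fun i : Fin k => e (Equiv.swap 0 p i.succ) :=
      he.comp ((Equiv.swap 0 p).injective.comp (Fin.succ_injective k))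
    have himg : (Finset.univ.image e).erase (e p)
        = Finset.univ.image fun i : Fin k => e (Equiv.swap 0 p i.succ) := by
      ext d
      simp only [Finset.mem_erase, Finset.mem_image, Finset.mem_univ, true_and]
      constructor
      · rintro ⟨hd, i, rfl⟩
        have hi : Equiv.swap 0 p i ≠ 0 := fun h => hd <| by
          rw [Equiv.swap_apply_eq_iff, Equiv.swap_apply_left] at h
          rw [h]
        obtain ⟨q, hq⟩ := Fin.exists_succ_eq.2 hi
        exact ⟨q, by rw [hq, Equiv.swap_apply_self]⟩
      · rintro ⟨i, rfl⟩
        refine ⟨fun h => ?_, _, rfl⟩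
        have := he h
        rw [Equiv.swap_apply_eq_iff, Equiv.swap_apply_right] at this
        exact Fin.succ_ne_zero i this
    rw [himg, ih _ _ _ he', Finset.prod_image he'.injOn, Finset.mul_sum]
    refine Finset.sum_congr rfl fun τ _ => ?_
    rw [Fin.prod_univ_succ]
    have hsel : ((selected (List.ofFn fun i : Fin k => y i.succ)).map
        fun b => 1 - Z b.1 / Z (e p)).prod = ∏ i : Fin k, (1 - Z (y i.succ) / Z (e p)) := by
      rw [selected, List.map_map, List.map_ofFn, List.prod_ofFn]
      rfl
    have hτ : ∏ i : Fin k, shuffleFactor Z H (e p) (e (Equiv.swap 0 p i.succ))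
        = ∏ i : Fin k, shuffleFactor Z H (e p) (e (Equiv.swap 0 p (τ i).succ)) :=
      (Equiv.prod_comp τ fun i => shuffleFactor Z H (e p) (e (Equiv.swap 0 p i.succ))).symm
    rw [hsel, hτ]
    simp only [Finset.prod_filter, Fin.prod_univ_succ, Equiv.Perm.decomposeFin_symm_apply_zero,
      Equiv.Perm.decomposeFin_symm_apply_succ, Fin.succ_lt_succ_iff, Fin.succ_pos, if_true,
      lt_self_iff_false, if_false, Fin.not_lt_zero, Finset.prod_const_one, mul_one, one_mul]
    congr 1
    exact Finset.prod_congr rfl fun i _ => by ring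

lemma permOfSubset_castLE {k : ℕ} (hk : k ≤ n) (J : Finset (Fin n)) (hJ : J.card = k)
    (i : Fin k) : permOfSubset hk J hJ (Fin.castLE hk i) = enum J hJ i := by
  have : (finCongr (Nat.add_sub_cancel' hk)).symm (Fin.castLE hk i)
      = finSumFinEquiv (Sum.inl i : Fin k ⊕ Fin (n - k)) := by
    ext
    simp
  simp only [permOfSubset, Equiv.trans_apply, this, Equiv.symm_apply_apply,
    Equiv.sumCongr_apply, Sum.map_inl, Equiv.sumCompl_apply_inl]
  rfl

lemma permOfSubset_mem_iff {k : ℕ} (hk : k ≤ n) (J : Finset (Fin n)) (hJ : J.card = k)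
    (a : Fin n) : permOfSubset hk J hJ a ∈ J ↔ a.1 < k := by
  obtain ⟨s, hs⟩ := finSumFinEquiv.surjective ((finCongr (Nat.add_sub_cancel' hk)).symm a)
  have hval : a.1 = (finSumFinEquiv s).1 := by
    rw [hs]
    rfl
  rcases s with i | i
  · have : permOfSubset hk J hJ a ∈ J := by
      simp only [permOfSubset, Equiv.trans_apply, ← hs, Equiv.symm_apply_apply,
        Equiv.sumCongr_apply, Sum.map_inl, Equiv.sumCompl_apply_inl]
      exact (J.orderIsoOfFin hJ i).2
    simp [this, hval]
  · have : permOfSubset hk J hJ a ∉ J := by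
      simp only [permOfSubset, Equiv.trans_apply, ← hs, Equiv.symm_apply_apply,
        Equiv.sumCongr_apply, Sum.map_inr, Equiv.sumCompl_apply_inr]
      exact ((Equiv.subtypeEquivRight fun x => Finset.mem_compl)
        ((Jᶜ.orderIsoOfFin (by simp [Finset.card_compl, hJ])).toEquiv i)).2
    simp [this, hval]

lemma enum_injective {k : ℕ} (J : Finset (Fin n)) (hJ : J.card = k) :
    Function.Injective (enum J hJ) :=
  Subtype.val_injective.comp (J.orderIsoOfFin hJ).injective

lemma image_enum {k : ℕ} (J : Finset (Fin n)) (hJ : J.card = k) :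
    Finset.univ.image (enum J hJ) = J := by
  ext a
  simp only [Finset.mem_image, Finset.mem_univ, true_and, enum]
  constructor
  · rintro ⟨i, rfl⟩
    exact Subtype.prop _
  · exact fun ha => ⟨(J.orderIsoOfFin hJ).symm ⟨a, ha⟩, by simp⟩

lemma prod_filter_castLE {k : ℕ} (hk : k ≤ n) (p : Fin n → Prop) [DecidablePred p]
    (hp : ∀ a, p a → a.1 < k) (f : Fin n → F) :
    ∏ a with p a, f a = ∏ a : Fin k with p (Fin.castLE hk a), f (Fin.castLE hk a) := by
  symm
  refine Finset.prod_bij (fun a _ => Fin.castLE hk a) (by simp) (by simp) (fun a ha => ?_)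
    (by simp)
  have ha' : p a := (Finset.mem_filter.1 ha).2
  exact ⟨⟨a.1, hp a ha'⟩, by simpa using ha', rfl⟩

lemma Ufun_permOfSubset {k : ℕ} (hk : k ≤ n) (J : Finset (Fin n)) (hJ : J.card = k)
    (T : Fin k → F) :
    Ufun n k T (Z ∘ permOfSubset hk J hJ) H =
      ∏ i, ((∏ a with a < i, (1 - H * Z (enum J hJ a) / T i)) *
        (∏ b with i < b, (1 - Z (enum J hJ b) / T i)) *
        ∏ j with i < j, ((1 - H * T j / T i) / (1 - T j / T i))) := by
  refine Finset.prod_congr rfl fun i _ => ?_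
  rw [prod_filter_castLE hk (fun a : Fin n => a.1 < i.1) fun a ha => ha.trans i.2,
    prod_filter_castLE hk (fun b : Fin n => i.1 < b.1 ∧ b.1 < k) fun a ha => ha.2]
  simp [permOfSubset_castLE]

lemma Winf_eq_weightVec [CharZero F] (hZ : Function.Injective Z) (h0 : ∀ a, Z a ≠ 0) {k : ℕ}
    (hk : k ≤ n) (I J : {s : Finset (Fin n) // s.card = k}) :
    Winf n k (fun a => Z (enum I.1 I.2 a)) (Z ∘ permOfSubset hk J.1 J.2) H =
      H ^ (k * (k - 1) / 2) * weightVec Z H (chamber n J.1) (fun _ => 1) I.1 := by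
  have hskip : ∀ (r : List (Fin n)) (l : List (Fin n × Bool)) (C : Fin n → F),
      weightVec Z H (skipped r ++ l) C
        = weightVec Z H l fun t => C t * (r.map fun a => 1 - H * Z a / Z t).prod := by
    intro r l
    induction r with
    | nil => simp
    | cons y r ih =>
      intro C
      funext I
      simp only [skipped_cons, List.cons_append, weightVec, ih, List.map_cons, List.prod_cons,
        mul_assoc]
  have hlist : weightVec Z H (chamber n J.1)
      = weightVec Z H (skipped J.1ᶜ.toList ++ (selected (List.ofFn (enum J.1 J.2)) ++ skipped [])) := by
    have hmem (a : Fin n) : a ∈ List.ofFn (enum J.1 J.2) ↔ a ∈ J.1 := by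
      conv_rhs => rw [← image_enum J.1 J.2]
      simp [List.mem_ofFn]
    refine (weightVec_eq_chamber hZ h0 ?_ (fun a => ?_) hmem fun a => ?_).symm
    · rw [List.append_nil, List.nodup_append]
      refine ⟨Finset.nodup_toList _, List.nodup_ofFn.2 (enum_injective _ _), ?_⟩
      rintro a ha b hb rfl
      rw [hmem] at hb
      simp [hb] at ha
    · simp [a.2]
    · simp
  have hcompl (t : F) : ∏ a : Fin n with k ≤ a.1, (1 - H * (Z ∘ permOfSubset hk J.1 J.2) a / t)
      = ∏ a ∈ J.1ᶜ, (1 - H * Z a / t) := by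
    refine Finset.prod_equiv (permOfSubset hk J.1 J.2) (fun a => ?_) fun a _ => rfl
    simp [permOfSubset_mem_iff]
  have hsum := weightVec_selected_ofFn (Z := Z) (H := H) (enum J.1 J.2) (enum I.1 I.2)
    (fun t => 1 * (J.1ᶜ.toList.map fun a => 1 - H * Z a / Z t).prod) (enum_injective _ _)
  rw [image_enum] at hsum
  rw [hlist, hskip, skipped_nil, List.append_nil, hsum, Winf, Wtrig, mul_assoc, Finset.sum_mul]
  congr 1
  refine Finset.sum_congr rfl fun σ _ => ?_
  rw [Ufun_permOfSubset, ← Equiv.prod_comp σ fun i : Fin k => ∏ a : Fin n with k ≤ a.1,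
      (1 - H * (Z ∘ permOfSubset hk J.1 J.2) a / Z (enum I.1 I.2 i)), ← Finset.prod_mul_distrib]
  refine Finset.prod_congr rfl fun i _ => ?_
  rw [hcompl, one_mul, Finset.prod_map_toList]
  simp only [Function.comp_apply, shuffleFactor]
  ring

lemma prod_prod_ite_eq_prod_pow_card {ι : Type*} [Fintype ι] (P : ι → Fin n → Fin n → Prop)
    [∀ J x z, Decidable (P J x z)] (f : Fin n → Fin n → F) :
    ∏ J, ∏ x, ∏ z, (if P J x z then f x z else 1)
      = ∏ x, ∏ z, f x z ^ (Finset.univ.filter fun J => P J x z).card := by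
  rw [Finset.prod_comm]
  refine Finset.prod_congr rfl fun x _ => ?_
  rw [Finset.prod_comm]
  refine Finset.prod_congr rfl fun z _ => ?_
  rw [← Finset.prod_filter, Finset.prod_const]

lemma card_subsets_mem_notMem {k : ℕ} (hk : 1 ≤ k) {x z : Fin n} (hxz : x ≠ z) :
    (Finset.univ.filter fun J : {s : Finset (Fin n) // s.card = k} => x ∈ J.1 ∧ z ∉ J.1).card
      = (n - 2).choose (k - 1) := by
  have hs : ((Finset.univ.erase x).erase z).card = n - 2 := by
    rw [Finset.card_erase_of_mem (by simp [hxz.symm]), Finset.card_erase_of_mem (by simp),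
      Finset.card_univ, Fintype.card_fin]
    omega
  rw [← hs, ← Finset.card_powersetCard]
  refine Finset.card_bij (fun J _ => J.1.erase x) (fun J hJ => ?_) (fun J hJ K hK h => ?_)
    fun s hs' => ?_
  · simp only [Finset.mem_filter, Finset.mem_univ, true_and] at hJ
    rw [Finset.mem_powersetCard, Finset.card_erase_of_mem hJ.1, J.2]
    refine ⟨fun a ha => ?_, rfl⟩
    simp only [Finset.mem_erase, Finset.mem_univ, and_true] at ha ⊢
    exact ⟨fun h => hJ.2 (h ▸ ha.2), ha.1⟩
  · simp only [Finset.mem_filter, Finset.mem_univ, true_and] at hJ hK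
    ext1
    rw [← Finset.insert_erase hJ.1, h, Finset.insert_erase hK.1]
  · obtain ⟨hsub, hcard⟩ := Finset.mem_powersetCard.1 hs'
    have hx : x ∉ s := fun h => by simpa using hsub h
    have hz : z ∉ s := fun h => by simpa using hsub h
    refine ⟨⟨insert x s, ?_⟩, ?_, Finset.erase_insert hx⟩
    · rw [Finset.card_insert_of_notMem hx, hcard]
      omega
    · simp [hxz.symm, hz]

lemma card_subsets_mem_mem {k : ℕ} (hk : 1 ≤ k) {x z : Fin n} (hxz : x ≠ z) :
    (Finset.univ.filter fun J : {s : Finset (Fin n) // s.card = k} => x ∈ J.1 ∧ z ∈ J.1).card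
      = if k = 1 then 0 else (n - 2).choose (k - 2) := by
  have two_le {s : Finset (Fin n)} (hx : x ∈ s) (hz : z ∈ s) : 2 ≤ s.card :=
    Finset.one_lt_card.2 ⟨x, hx, z, hz, hxz⟩
  split_ifs with hk1
  · rw [Finset.card_eq_zero, Finset.filter_eq_empty_iff]
    rintro J - ⟨hx, hz⟩
    have := two_le hx hz
    rw [J.2] at this
    omega
  have hs : ((Finset.univ.erase x).erase z).card = n - 2 := by
    rw [Finset.card_erase_of_mem (by simp [hxz.symm]), Finset.card_erase_of_mem (by simp),
      Finset.card_univ, Fintype.card_fin]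
    omega
  rw [← hs, ← Finset.card_powersetCard]
  refine Finset.card_bij (fun J _ => (J.1.erase x).erase z) (fun J hJ => ?_)
    (fun J hJ K hK h => ?_) fun s hs' => ?_
  · simp only [Finset.mem_filter, Finset.mem_univ, true_and] at hJ
    rw [Finset.mem_powersetCard, Finset.card_erase_of_mem (by simp [hxz.symm, hJ]),
      Finset.card_erase_of_mem hJ.1, J.2]
    exact ⟨Finset.erase_subset_erase _ (Finset.erase_subset_erase _ (Finset.subset_univ _)),
      by omega⟩
  · simp only [Finset.mem_filter, Finset.mem_univ, true_and] at hJ hK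
    ext1
    rw [← Finset.insert_erase hJ.1, ← Finset.insert_erase hK.1,
      ← Finset.insert_erase (Finset.mem_erase.2 ⟨hxz.symm, hJ.2⟩), h,
      Finset.insert_erase (Finset.mem_erase.2 ⟨hxz.symm, hK.2⟩)]
  · obtain ⟨hsub, hcard⟩ := Finset.mem_powersetCard.1 hs'
    have hx : x ∉ s := fun h => by simpa using hsub h
    have hz : z ∉ s := fun h => by simpa using hsub h
    have hx' : x ∉ insert z s := by simp [hxz, hx]
    refine ⟨⟨insert x (insert z s), ?_⟩, by simp, ?_⟩
    · rw [Finset.card_insert_of_notMem hx', Finset.card_insert_of_notMem hz, hcard]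
      omega
    · simp only [Finset.erase_insert hx', Finset.erase_insert hz]

/-- A product over the ordered pairs of distinct indices, grouped by unordered pairs. -/
lemma prod_prod_ne_eq (f : Fin n → Fin n → F) :
    ∏ x, ∏ z with z ≠ x, f x z = ∏ a, ∏ b with b < a, (f a b * f b a) := by
  have hsplit (x : Fin n) : ∏ z with z ≠ x, f x z
      = (∏ z with z < x, f x z) * ∏ z with x < z, f x z := by
    rw [← Finset.prod_filter_mul_prod_filter_not _ (fun z => z < x), Finset.filter_filter,
      Finset.filter_filter]
    congr 1 <;> refine Finset.prod_congr (Finset.filter_congr fun z _ => ?_) fun _ _ => rfl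
    · exact ⟨And.right, fun h => ⟨h.ne, h⟩⟩
    · rw [not_lt, lt_iff_le_and_ne, ne_comm, and_comm]
  have hcomm : ∏ x, ∏ z with x < z, f x z = ∏ a, ∏ b with b < a, f b a :=
    Finset.prod_comm' fun x z => by simp
  simp only [hsplit, Finset.prod_mul_distrib, hcomm]

lemma prod_crossingFactor (hZ : Function.Injective Z) (hHZ : ∀ a b, a ≠ b → H * Z a ≠ Z b) :
    ∏ x, ∏ z with z ≠ x, crossingFactor Z H x z = H ^ (n * (n - 1) / 2) := by
  have key (a b : Fin n) (hab : b < a) : crossingFactor Z H a b * crossingFactor Z H b a = H := by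
    have h₁ : Z a - Z b ≠ 0 := sub_ne_zero.2 (hZ.ne hab.ne')
    have h₂ : H * Z b - Z a ≠ 0 := sub_ne_zero.2 (hHZ b a hab.ne)
    rw [crossingFactor, crossingFactor, if_neg hab.not_gt, if_pos hab]
    field_simp
    ring
  rw [prod_prod_ne_eq]
  have hrow (a : Fin n) :
      ∏ b with b < a, (crossingFactor Z H a b * crossingFactor Z H b a) = H ^ a.1 := by
    rw [Finset.prod_congr rfl fun b hb => key a b (Finset.mem_filter.1 hb).2, Finset.prod_const]
    congr 1
    rw [Finset.filter_gt_eq_Iio, Fin.card_Iio]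
  rw [Finset.prod_congr rfl fun a _ => hrow a, Finset.prod_pow_eq_pow_sum,
    Fin.sum_univ_eq_sum_range (fun i => i), Finset.sum_range_id]

/-- A product over the pairs of a member and a non-member of the `k`-element subsets. -/
lemma prod_subsets_mem_notMem {k : ℕ} (hk : 1 ≤ k) (f : Fin n → Fin n → F) :
    ∏ J : {s : Finset (Fin n) // s.card = k}, ∏ x ∈ J.1, ∏ z ∈ J.1ᶜ, f x z
      = ∏ x, ∏ z with z ≠ x, f x z ^ (n - 2).choose (k - 1) := by
  have hite (J : {s : Finset (Fin n) // s.card = k}) : ∏ x ∈ J.1, ∏ z ∈ J.1ᶜ, f x z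
      = ∏ x, ∏ z, if x ∈ J.1 ∧ z ∉ J.1 then f x z else 1 := by
    rw [← Finset.prod_ite_mem_eq]
    refine Finset.prod_congr rfl fun x _ => ?_
    rw [← Finset.prod_ite_mem_eq]
    by_cases hx : x ∈ J.1 <;> simp [hx]
  rw [Finset.prod_congr rfl fun J _ => hite J, prod_prod_ite_eq_prod_pow_card]
  refine Finset.prod_congr rfl fun x _ => ?_
  rw [Finset.prod_filter]
  refine Finset.prod_congr rfl fun z _ => ?_
  split_ifs with h
  · rw [card_subsets_mem_notMem hk (Ne.symm h)]
  · rw [not_not.1 h]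
    simp

/-- A product over the pairs of distinct members of the `k`-element subsets. -/
lemma prod_subsets_mem_mem {k : ℕ} (hk : 1 ≤ k) (f : Fin n → Fin n → F) :
    ∏ J : {s : Finset (Fin n) // s.card = k}, ∏ x ∈ J.1, ∏ z ∈ J.1.erase x, f x z
      = ∏ x, ∏ z with z ≠ x, f x z ^ (if k = 1 then 0 else (n - 2).choose (k - 2)) := by
  have hite (J : {s : Finset (Fin n) // s.card = k}) : ∏ x ∈ J.1, ∏ z ∈ J.1.erase x, f x z
      = ∏ x, ∏ z, if (x ∈ J.1 ∧ z ∈ J.1) ∧ z ≠ x then f x z else 1 := by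
    rw [← Finset.prod_ite_mem_eq]
    refine Finset.prod_congr rfl fun x _ => ?_
    rw [← Finset.prod_ite_mem_eq]
    by_cases hx : x ∈ J.1 <;> simp [hx, and_comm]
  rw [Finset.prod_congr rfl fun J _ => hite J, prod_prod_ite_eq_prod_pow_card]
  refine Finset.prod_congr rfl fun x _ => ?_
  rw [Finset.prod_filter]
  refine Finset.prod_congr rfl fun z _ => ?_
  by_cases h : z = x
  · simp [h]
  · simp only [h, ne_eq, not_false_eq_true, and_true, if_true]
    rw [card_subsets_mem_mem hk (Ne.symm h)]

lemma choose_exponent_identity {k : ℕ} (hk1 : 1 ≤ k) (hk : k ≤ n) :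
    k * (k - 1) / 2 * n.choose k + n * (n - 1) / 2 * (n - 2).choose (k - 1)
      = n * (n - 1) / 2 * (n - 1).choose (k - 1) := by
  obtain rfl | hk2 := hk1.eq_or_lt
  · simp
  · have h := Nat.choose_mul (n := n) (show 2 ≤ k from hk2)
    obtain ⟨k, rfl⟩ := Nat.exists_eq_add_of_le' (show 2 ≤ k from hk2)
    obtain ⟨m, rfl⟩ := Nat.exists_eq_add_of_le' (show 2 ≤ n by omega)
    rw [← Nat.choose_two_right, ← Nat.choose_two_right]
    simp only [Nat.add_sub_cancel, Nat.add_succ_sub_one] at h ⊢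
    rw [Nat.choose_succ_succ m k]
    linarith

lemma det_Winf [CharZero F] (hZ : Function.Injective Z) (h0 : ∀ a, Z a ≠ 0)
    (hH : H ≠ 0) (hHZ : ∀ a b, a ≠ b → H * Z a ≠ Z b) {k : ℕ} (hk1 : 1 ≤ k) (hk : k ≤ n) :
    (Matrix.of fun I J : {s : Finset (Fin n) // s.card = k} =>
        Winf n k (fun a => Z (enum I.1 I.2 a)) (Z ∘ permOfSubset hk J.1 J.2) H).det
      = H ^ (n * (n - 1) / 2 * Nat.choose (n - 1) (k - 1)) * Dhat n k Z H := by
  have hM : (Matrix.of fun I J : {s : Finset (Fin n) // s.card = k} =>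
        Winf n k (fun a => Z (enum I.1 I.2 a)) (Z ∘ permOfSubset hk J.1 J.2) H)
      = H ^ (k * (k - 1) / 2) • chamberMatrix Z H k n := by
    ext I J
    simp [chamberMatrix, Winf_eq_weightVec hZ h0]
  have hcross : ∏ z : Fin n with z.1 < n, ∏ J : {s : Finset (Fin n) // s.card = k} with z ∉ J.1,
      ∏ x ∈ J.1, crossingFactor Z H x z = H ^ (n * (n - 1) / 2 * (n - 2).choose (k - 1)) := by
    have h₁ : (Finset.univ.filter fun z : Fin n => z.1 < n) = Finset.univ := by simp
    rw [h₁, Finset.prod_comm' (t' := Finset.univ) (s' := fun J => J.1ᶜ) fun z J => by simp]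
    rw [Finset.prod_congr rfl fun J _ => Finset.prod_comm, prod_subsets_mem_notMem hk1]
    simp only [Finset.prod_pow]
    rw [prod_crossingFactor hZ hHZ, pow_mul]
  have hR : ∏ x, ∏ z with z ≠ x, (1 - Z z / Z x) ^ (n - 2).choose (k - 1)
      = Dfun n k Z * Dfun n k fun a => (Z a)⁻¹ := by
    rw [prod_prod_ne_eq, Dfun, Dfun, ← Finset.prod_mul_distrib]
    refine Finset.prod_congr rfl fun a _ => ?_
    rw [← Finset.prod_mul_distrib]
    refine Finset.prod_congr rfl fun b _ => ?_
    rw [mul_comm, inv_div_inv]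
  have hcard : Fintype.card {s : Finset (Fin n) // s.card = k} = n.choose k := by
    simp
  rw [hM, Matrix.det_smul, det_chamberMatrix hZ h0 hH hHZ k le_rfl, hcross,
    det_chamberMatrix_zero hZ h0, Finset.prod_mul_distrib, prod_subsets_mem_mem hk1,
    prod_subsets_mem_notMem hk1 fun a b => 1 - Z b / Z a, hR, hcard, ← pow_mul, ← mul_assoc,
    ← pow_add, choose_exponent_identity hk1 hk, Dhat, mul_comm (Dfun n k Z * _)]
  rfl

end WeightVectors

lemma algebraMap_ZF_injective (n : ℕ) :
    Function.Injective (algebraMap (MvPolynomial (Fin n ⊕ Unit) ℂ) (ZF n)) :=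
  IsFractionRing.injective _ _

lemma ZV_injective (n : ℕ) : Function.Injective (ZV n) :=
  (algebraMap_ZF_injective n).comp ((MvPolynomial.X_injective).comp Sum.inl_injective)

lemma ZV_ne_zero {n : ℕ} (a : Fin n) : ZV n a ≠ 0 :=
  (map_ne_zero_iff _ (algebraMap_ZF_injective n)).2 (X_ne_zero _)

lemma HV_ne_zero (n : ℕ) : HV n ≠ 0 :=
  (map_ne_zero_iff _ (algebraMap_ZF_injective n)).2 (X_ne_zero _)

lemma HV_mul_ZV_ne_ZV {n : ℕ} (a b : Fin n) : HV n * ZV n a ≠ ZV n b := by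
  rw [HV, ZV, ZV, ← map_mul]
  intro h
  have := congrArg (eval (Sum.elim (fun _ => (1 : ℂ)) fun _ => 0)) (algebraMap_ZF_injective n h)
  simp at this

/-- Proposition 3.5, second formula:
`det (𝒲^∞(Z_I; Z_{σ_J}; H))_{I,J} = H^{(n(n−1)/2)·binom(n−1,k−1)} D̂(Z;H)`. -/
theorem det_opposite_trig_weight_matrix (n k : ℕ) (hk1 : 1 ≤ k) (hk : k ≤ n) :
    (Matrix.of fun I J : {s : Finset (Fin n) // s.card = k} =>
        Winf n k (fun a => ZV n (enum I.1 I.2 a))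
          (ZV n ∘ permOfSubset hk J.1 J.2) (HV n)).det
      = HV n ^ ((n * (n - 1) / 2 * Nat.choose (n - 1) (k - 1) : ℕ)) *
          Dhat n k (ZV n) (HV n) := by
  have : CharZero (ZF n) := charZero_of_injective_algebraMap (algebraMap_ZF_injective n)
  exact det_Winf (ZV_injective n) ZV_ne_zero (HV_ne_zero n) (fun a b _ => HV_mul_ZV_ne_ZV a b) hk1 hk

end
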